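/- Let q be a prime power and let C be an [n,k]_q maximum weight spectrum code satisfying property (A). Then there exists a [2n+1, k+1]_q maximum weight spectrum code. -/

import Mathlib

/-- The Hamming weight of a vector: the number of nonzero coordinates. -/
def wt {ι F : Type*} [Fintype ι] [Zero F] [DecidableEq F] (c : ι → F) : ℕ :=
  (Finset.univ.filter fun i => c i ≠ 0).card

/-- The weight set of a code: the set of nonzero weights of nonzero codewords. -/
def wtSet {ι F : Type*} [Fintype ι] [Zero F] [DecidableEq F] (C : Set (ι → F)) : Set ℕ :=
  {w | ∃ c ∈ C, c ≠ 0 ∧ wt c = w}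

/-- `cnt c β` is the number of coordinates of `c` equal to `β` (denoted `c[β]`). -/
def cnt {ι F : Type*} [Fintype ι] [DecidableEq F] (c : ι → F) (β : F) : ℕ :=
  (Finset.univ.filter fun i => c i = β).card

/-- Property (A): there is a nonzero `β` such that the count `c[β]` separates codewords. -/
def propA {ι F : Type*} [Fintype ι] [Field F] [DecidableEq F]
    (C : Submodule F (ι → F)) : Prop :=
  ∃ β : F, β ≠ 0 ∧ ∀ a ∈ C, ∀ b ∈ C, cnt a β = cnt b β → a = b

lemma wt_comp_equiv {ι κ F : Type*} [Fintype ι] [Fintype κ] [Zero F] [DecidableEq F]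
    (c : ι → F) (e : κ ≃ ι) : wt (c ∘ e) = wt c := by
  simp only [wt, Finset.card_filter, Function.comp_apply]
  exact e.sum_comp fun i => if c i ≠ 0 then 1 else 0

lemma wt_sumElim {ι κ F : Type*} [Fintype ι] [Fintype κ] [Zero F] [DecidableEq F]
    (a : ι → F) (b : κ → F) : wt (Sum.elim a b) = wt a + wt b := by
  simp only [wt, Finset.card_filter, Fintype.sum_sum_type, Sum.elim_inl, Sum.elim_inr]
  rfl

lemma wt_const_of_ne_zero {ι F : Type*} [Fintype ι] [Zero F] [DecidableEq F]
    {x : F} (hx : x ≠ 0) : wt (fun _ : ι => x) = Fintype.card ι := by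
  simp [wt, hx]

lemma wt_zero {ι F : Type*} [Fintype ι] [Zero F] [DecidableEq F] :
    wt (0 : ι → F) = 0 := by
  simp [wt]

lemma wt_le_card {ι F : Type*} [Fintype ι] [Zero F] [DecidableEq F] (c : ι → F) :
    wt c ≤ Fintype.card ι :=
  Finset.card_filter_le _ _

lemma finite_wtSet {ι F : Type*} [Fintype ι] [Zero F] [DecidableEq F] (C : Set (ι → F)) :
    (wtSet C).Finite := by
  refine (Set.finite_Iic (Fintype.card ι)).subset ?_
  rintro _ ⟨c, -, -, rfl⟩
  exact wt_le_card c

lemma wt_smul {ι F : Type*} [Fintype ι] [Field F] [DecidableEq F] {x : F} (hx : x ≠ 0)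
    (c : ι → F) : wt (x • c) = wt c := by
  simp [wt, hx]

lemma cnt_le_card {ι F : Type*} [Fintype ι] [DecidableEq F] (c : ι → F) (β : F) :
    cnt c β ≤ Fintype.card ι :=
  Finset.card_filter_le _ _

lemma wt_sub_const_add_cnt {ι F : Type*} [Fintype ι] [Field F] [DecidableEq F]
    (c : ι → F) (β : F) : wt (c - fun _ => β) + cnt c β = Fintype.card ι := by
  have h := Finset.card_filter_add_card_filter_not (s := (Finset.univ : Finset ι))
    fun i => c i = β
  simp only [wt, cnt, Pi.sub_apply, ne_eq, sub_eq_zero]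
  rw [Finset.card_univ] at h
  omega

/-- The linear map sending `(c, x)` to the word `(c - x β 𝟏 | x 𝟏)`, the second block being
indexed by `κ`. -/
def extendMap {ι κ F : Type*} [Field F] (C : Submodule F (ι → F)) (β : F) :
    C × F →ₗ[F] (ι ⊕ κ → F) where
  toFun p := Sum.elim ((p.1 : ι → F) - fun _ => p.2 * β) fun _ => p.2
  map_add' p r := by
    ext (i | i)
    · simp only [Sum.elim_inl, Pi.add_apply, Pi.sub_apply, Prod.fst_add, Prod.snd_add,
        Submodule.coe_add]
      ring
    · simp
  map_smul' x p := by
    ext (i | i)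
    · simp [mul_sub, mul_assoc]
    · simp

lemma extendMap_injective {ι κ F : Type*} [Field F] [Nonempty κ] (C : Submodule F (ι → F))
    (β : F) : Function.Injective (extendMap (κ := κ) C β) := by
  refine (injective_iff_map_eq_zero _).2 fun ⟨c, x⟩ h => ?_
  have hx : x = 0 := congrFun h (Sum.inr (Classical.arbitrary κ))
  subst hx
  have hc : c = 0 := by
    ext i
    simpa [extendMap] using congrFun h (Sum.inl i)
  rw [hc, Prod.mk_zero_zero]

lemma wt_extendMap_zero {ι κ F : Type*} [Fintype ι] [Fintype κ] [Field F] [DecidableEq F]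
    (C : Submodule F (ι → F)) (β : F) (c : C) :
    wt (extendMap (κ := κ) C β (c, 0)) = wt (c : ι → F) := by
  have h : extendMap (κ := κ) C β (c, 0) = Sum.elim (c : ι → F) (0 : κ → F) := by
    ext (i | i) <;> simp [extendMap]
  rw [h, wt_sumElim, wt_zero, add_zero]

lemma wt_extendMap_one {ι κ F : Type*} [Fintype ι] [Fintype κ] [Field F] [DecidableEq F]
    (C : Submodule F (ι → F)) (β : F) (c : C) :
    wt (extendMap (κ := κ) C β (c, 1)) =
      Fintype.card ι + Fintype.card κ - cnt (c : ι → F) β := by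
  have h : extendMap (κ := κ) C β (c, 1) =
      Sum.elim ((c : ι → F) - fun _ => β) fun _ => 1 := by
    ext (i | i) <;> simp [extendMap]
  rw [h, wt_sumElim, wt_const_of_ne_zero one_ne_zero, ← wt_sub_const_add_cnt (c : ι → F) β]
  omega

lemma wtSet_range_extendMap {ι κ F : Type*} [Fintype ι] [Fintype κ] [Nonempty κ] [Field F]
    [DecidableEq F] (C : Submodule F (ι → F)) (β : F) :
    wtSet ((extendMap (κ := κ) C β).range : Set (ι ⊕ κ → F)) =
      wtSet (C : Set (ι → F)) ∪
        Set.range fun c : C => Fintype.card ι + Fintype.card κ - cnt (c : ι → F) β := by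
  have hinj := extendMap_injective (κ := κ) C β
  ext w
  constructor
  · rintro ⟨_, ⟨⟨c, x⟩, rfl⟩, hne, rfl⟩
    by_cases hx : x = 0
    · subst hx
      refine Or.inl ⟨c, c.2, fun hc => hne ?_, (wt_extendMap_zero C β c).symm⟩
      rw [show c = 0 from Subtype.ext hc, Prod.mk_zero_zero, map_zero]
    · refine Or.inr ⟨x⁻¹ • c, ?_⟩
      have h : ((x⁻¹ • c, 1) : C × F) = x⁻¹ • (c, x) := by
        simp [hx]
      rw [← wt_smul (inv_ne_zero hx), ← map_smul, ← h, wt_extendMap_one]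
  · rintro (⟨c, hc, hne, rfl⟩ | ⟨c, rfl⟩)
    · refine ⟨_, ⟨(⟨c, hc⟩, 0), rfl⟩, fun h => hne ?_, wt_extendMap_zero C β ⟨c, hc⟩⟩
      have h' := hinj (h.trans (map_zero _).symm)
      exact congrArg Subtype.val (congrArg Prod.fst h')
    · refine ⟨_, ⟨(c, 1), rfl⟩, fun h => ?_, wt_extendMap_one C β c⟩
      have h' := hinj (h.trans (map_zero _).symm)
      exact one_ne_zero (congrArg Prod.snd h')

lemma wtSet_map_funLeft {ι κ F : Type*} [Fintype ι] [Fintype κ] [Field F] [DecidableEq F]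
    (D : Submodule F (ι → F)) (e : κ ≃ ι) :
    wtSet (D.map (LinearEquiv.funCongrLeft F F e : (ι → F) →ₗ[F] κ → F) : Set (κ → F)) =
      wtSet (D : Set (ι → F)) := by
  ext w
  constructor
  · rintro ⟨_, ⟨c, hc, rfl⟩, hne, rfl⟩
    refine ⟨c, hc, fun h => hne (by rw [h, map_zero]), (wt_comp_equiv c e).symm⟩
  · rintro ⟨c, hc, hne, rfl⟩
    exact ⟨_, ⟨c, hc, rfl⟩, (LinearEquiv.map_ne_zero_iff _).2 hne, wt_comp_equiv c e⟩

lemma pow_sub_one_div_add_pow {q : ℕ} (hq : 1 < q) (k : ℕ) :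
    (q ^ k - 1) / (q - 1) + q ^ k = (q ^ (k + 1) - 1) / (q - 1) := by
  rw [← Nat.geomSum_eq hq, ← Nat.geomSum_eq hq, Finset.sum_range_succ]

/-- If `C` is an `[n,k]_q` maximum weight spectrum code satisfying property (A), then
there exists a `[2n+1, k+1]_q` maximum weight spectrum code. -/
theorem MWS_propA_extend (q n k : ℕ) (hq : IsPrimePow q)
    (F : Type*) [Field F] [Fintype F] [DecidableEq F] (hcard : Fintype.card F = q)
    (C : Submodule F (Fin n → F)) (hdim : Module.finrank F C = k)
    (hMWS : (wtSet (C : Set (Fin n → F))).ncard = (q ^ k - 1) / (q - 1))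
    (hA : propA C) :
    ∃ D : Submodule F (Fin (2 * n + 1) → F),
      Module.finrank F D = k + 1 ∧
      (wtSet (D : Set (Fin (2 * n + 1) → F))).ncard = (q ^ (k + 1) - 1) / (q - 1) := by
  obtain ⟨β, -, hA⟩ := hA
  let e : Fin (2 * n + 1) ≃ Fin n ⊕ Fin (n + 1) :=
    (finCongr (by omega)).trans finSumFinEquiv.symm
  refine ⟨(extendMap (κ := Fin (n + 1)) C β).range.map
    (LinearEquiv.funCongrLeft F F e : (Fin n ⊕ Fin (n + 1) → F) →ₗ[F] Fin (2 * n + 1) → F),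
    ?_, ?_⟩
  · rw [LinearEquiv.finrank_map_eq, LinearMap.finrank_range_of_inj (extendMap_injective C β),
      Module.finrank_prod, hdim, Module.finrank_self]
  · rw [wtSet_map_funLeft, wtSet_range_extendMap,
      Set.ncard_union_eq ?_ (finite_wtSet _) (Set.finite_range _), hMWS,
      Set.ncard_range_of_injective, Module.natCard_eq_pow_finrank (K := F),
      Nat.card_eq_fintype_card, hdim, hcard, pow_sub_one_div_add_pow hq.one_lt]
    · intro a b hab
      have ha := cnt_le_card (a : Fin n → F) β
      have hb := cnt_le_card (b : Fin n → F) β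
      exact Subtype.ext (hA a a.2 b b.2 (by simp only at hab; omega))
    · rw [Set.disjoint_left]
      rintro _ ⟨c, -, -, rfl⟩ ⟨b, hb⟩
      have hc := wt_le_card c
      have hb' := cnt_le_card (b : Fin n → F) β
      simp only [Fintype.card_fin] at *
      omega
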